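/- arXiv:1306.4773 — 7 statements merged into one kernel-verified Lean document; each statement's English description precedes it below -/
import Mathlib

section
/- (Lemma 1) The multiclass FIFO system is a Guaranteed Rate server with rate R = C_min and error term E = 0 to the aggregate input: for every packet index j ≥ 1, d(j) ≤ GRC_j(C_min), where GRC is the guaranteed-rate clock of the aggregate flow with rate C_min. -/
open scoped Classical BigOperators

/-- Lemma 1: the multiclass FIFO system is a Guaranteed Rate server with
rate `Cmin` and error term `0` to the aggregate input. -/
theorem multiclass_fifo_GR_aggregate
    (N : ℕ) (hN : 0 < N)
    (C : Fin N → ℝ) (hC : ∀ n, 0 < C n)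
    (Cmin : ℝ) (hCmin : IsLeast (Set.range C) Cmin)
    (a l : ℕ → ℝ) (c : ℕ → Fin N)
    (ha0 : ∀ j, 0 ≤ a j) (hamono : Monotone a)
    (hl : ∀ j, 1 ≤ j → 0 < l j)
    (d : ℕ → ℝ) (hd0 : d 0 = 0)
    (hd : ∀ j, 1 ≤ j → d j = max (a j) (d (j - 1)) + l j / C (c j))
    (GRC : ℕ → ℝ) (hG0 : GRC 0 = 0)
    (hG : ∀ j, 1 ≤ j → GRC j = max (a j) (GRC (j - 1)) + l j / Cmin) :
    ∀ j, 1 ≤ j → d j ≤ GRC j + 0 := by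
  obtain ⟨⟨m, rfl⟩, hmin⟩ := hCmin
  have hle : ∀ j, d j ≤ GRC j := by
    intro j
    induction j with
    | zero => rw [hd0, hG0]
    | succ k ih =>
      rw [hd _ k.succ_pos, hG _ k.succ_pos]
      exact add_le_add (max_le_max le_rfl ih)
        (div_le_div_of_nonneg_left (hl _ k.succ_pos).le (hC m)
          (hmin (Set.mem_range_self _)))
  intro j _
  rw [add_zero]
  exact hle j
end

section
/- For any rate R > 0, any packet index i and any index i0 with 1 ≤ i0 ≤ i, the guaranteed-rate clock satisfies GRC_i(R) ≥ a(i0) + Σ_{k=i0}^{i} l(k)/R. -/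
open scoped Classical BigOperators

/-- For any rate `R > 0`, any packet index `i` and any `i0` with `1 ≤ i0 ≤ i`,
the guaranteed-rate clock satisfies `GRC i ≥ a i0 + ∑_{k=i0}^{i} l k / R`. -/
theorem GRC_lower_bound
    (a l : ℕ → ℝ) (ha0 : ∀ i, 0 ≤ a i) (hl : ∀ i, 1 ≤ i → 0 < l i)
    (R : ℝ) (hR : 0 < R)
    (GRC : ℕ → ℝ) (hG0 : GRC 0 = 0)
    (hG : ∀ i, 1 ≤ i → GRC i = max (a i) (GRC (i - 1)) + l i / R) :
    ∀ i i0, 1 ≤ i0 → i0 ≤ i →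
      GRC i ≥ a i0 + ∑ k ∈ Finset.Icc i0 i, l k / R := by
  intro i i0 h1 h
  induction i, h using Nat.le_induction with
  | base =>
    rw [hG i0 h1, Finset.Icc_self, Finset.sum_singleton]
    linarith [le_max_left (a i0) (GRC (i0 - 1))]
  | succ n hn ih =>
    rw [Finset.sum_Icc_succ_top (by omega), hG (n + 1) (by omega), Nat.add_sub_cancel]
    linarith [le_max_right (a (n + 1)) (GRC n)]
end

section
/- (Corollary 1, direct delay bound) If Σ_n r_n ≤ C_min, then the delay of every packet is bounded by D(j) = d(j) − a(j) ≤ (Σ_n σ_n)/C_min. -/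
open scoped Classical BigOperators

/-- In a FIFO queue fed by arrivals `a` with service times `s`, every departure time is the start
of a busy period plus the service times accumulated since. -/
theorem exists_departure_eq_arrival_add_sum (a s d : ℕ → ℝ) (ha1 : 0 ≤ a 1) (hd0 : d 0 = 0)
    (hd : ∀ j, 1 ≤ j → d j = max (a j) (d (j - 1)) + s j) (j : ℕ) (hj : 1 ≤ j) :
    ∃ k, 1 ≤ k ∧ k ≤ j ∧ d j = a k + ∑ i ∈ Finset.Icc k j, s i := by
  induction j, hj using Nat.le_induction with
  | base => exact ⟨1, le_rfl, le_rfl, by simp [hd 1 le_rfl, hd0, ha1]⟩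
  | succ j hj ih =>
    obtain ⟨k, hk, hkj, hdk⟩ := ih
    have hrec := hd (j + 1) (by omega)
    rw [Nat.add_sub_cancel] at hrec
    rcases le_total (d j) (a (j + 1)) with h | h
    · exact ⟨j + 1, by omega, le_rfl, by simp [hrec, h]⟩
    · refine ⟨k, hk, by omega, ?_⟩
      rw [hrec, max_eq_right h, hdk, Finset.sum_Icc_succ_top (by omega), add_assoc]

/-- Corollary 1 (direct delay bound): if `∑ n, r n ≤ Cmin`, the delay of every
packet is bounded by `(∑ n, σ n) / Cmin`. -/
theorem multiclass_fifo_direct_delay_bound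
    (N : ℕ) (hN : 0 < N)
    (C : Fin N → ℝ) (hC : ∀ n, 0 < C n)
    (Cmin : ℝ) (hCmin : IsLeast (Set.range C) Cmin)
    (a l : ℕ → ℝ) (c : ℕ → Fin N)
    (ha0 : ∀ j, 0 ≤ a j) (hamono : Monotone a)
    (hl : ∀ j, 1 ≤ j → 0 < l j)
    (hfin : ∀ t : ℝ, {j : ℕ | a j ≤ t}.Finite)
    (d : ℕ → ℝ) (hd0 : d 0 = 0)
    (hd : ∀ j, 1 ≤ j → d j = max (a j) (d (j - 1)) + l j / C (c j))
    (r σ : Fin N → ℝ) (hr : ∀ n, 0 ≤ r n) (hσ : ∀ n, 0 ≤ σ n)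
    (harr : ∀ n : Fin N, ∀ s t : ℝ, 0 ≤ s → s ≤ t →
      (∑' j : ℕ, if 1 ≤ j ∧ c j = n ∧ s ≤ a j ∧ a j ≤ t then l j else 0)
        ≤ r n * (t - s) + σ n)
    (hcond : ∑ n, r n ≤ Cmin) :
    ∀ j, 1 ≤ j → d j - a j ≤ (∑ n, σ n) / Cmin := by
  intro j hj
  obtain ⟨⟨m, hm⟩, hmin⟩ := hCmin
  have hpos : 0 < Cmin := hm ▸ hC m
  obtain ⟨k, hk, hkj, hdj⟩ :=
    exists_departure_eq_arrival_add_sum a (fun i => l i / C (c i)) d (ha0 1) hd0 hd j hj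
  have hclass : ∀ n, ∑ i ∈ Finset.Icc k j, (if c i = n then l i else 0)
      ≤ r n * (a j - a k) + σ n := by
    intro n
    refine le_trans ?_ (harr n (a k) (a j) (ha0 k) (hamono hkj))
    refine le_of_eq_of_le (Finset.sum_congr rfl fun i hi => ?_)
      (Summable.sum_le_tsum (Finset.Icc k j) (fun i _ => ?_) ?_)
    · obtain ⟨h1, h2⟩ := Finset.mem_Icc.mp hi
      simp [hk.trans h1, hamono h1, hamono h2]
    · split_ifs with h
      exacts [(hl i h.1).le, le_rfl]
    · refine summable_of_hasFiniteSupport ((hfin (a j)).subset fun i hi => ?_)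
      by_contra h
      exact hi (if_neg fun h' => h h'.2.2.2)
  have htotal : ∑ i ∈ Finset.Icc k j, l i ≤ Cmin * (a j - a k) + ∑ n, σ n := by
    calc ∑ i ∈ Finset.Icc k j, l i
        = ∑ n, ∑ i ∈ Finset.Icc k j, (if c i = n then l i else 0) := by
          rw [Finset.sum_comm]
          simp
      _ ≤ ∑ n, (r n * (a j - a k) + σ n) := Finset.sum_le_sum fun n _ => hclass n
      _ = (∑ n, r n) * (a j - a k) + ∑ n, σ n := by
          rw [Finset.sum_add_distrib, Finset.sum_mul]
      _ ≤ Cmin * (a j - a k) + ∑ n, σ n := by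
          gcongr
          exact sub_nonneg.mpr (hamono hkj)
  have hservice : ∑ i ∈ Finset.Icc k j, l i / C (c i) ≤ (∑ i ∈ Finset.Icc k j, l i) / Cmin := by
    rw [Finset.sum_div]
    refine Finset.sum_le_sum fun i hi => ?_
    exact div_le_div_of_nonneg_left (hl i (hk.trans (Finset.mem_Icc.mp hi).1)).le hpos
      (hmin ⟨c i, rfl⟩)
  have hdiv : (∑ i ∈ Finset.Icc k j, l i) / Cmin ≤ a j - a k + (∑ n, σ n) / Cmin := by
    rw [div_le_iff₀ hpos, add_mul, div_mul_cancel₀ _ hpos.ne']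
    linarith
  linarith
end

section
/- (Corollary 2, direct backlog bound) If Σ_n r_n ≤ C_min, then the backlog at any time t satisfies B(t) = A(t) − A*(t) ≤ Σ_n σ_n + (Σ_n r_n)·L/C_min. -/
open scoped Classical BigOperators

/-- The departure time of a FIFO packet is at most the arrival time of the packet opening its busy
period plus the time needed to serve everything from then on at the minimum rate. -/
theorem exists_departure_le_arrival_add_sum_div {a l d w : ℕ → ℝ} {m : ℝ} (hm : 0 < m)
    (hw : ∀ j, 1 ≤ j → m ≤ w j) (ha : 0 ≤ a 1) (hl : ∀ j, 1 ≤ j → 0 < l j) (hd0 : d 0 = 0)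
    (hd : ∀ j, 1 ≤ j → d j = max (a j) (d (j - 1)) + l j / w j) (k : ℕ) (hk : 1 ≤ k) :
    ∃ i, 1 ≤ i ∧ i ≤ k ∧ d k ≤ a i + (∑ j ∈ Finset.Ico i (k + 1), l j) / m := by
  have hserve : ∀ j, 1 ≤ j → l j / w j ≤ l j / m := fun j hj =>
    div_le_div_of_nonneg_left (hl j hj).le hm (hw j hj)
  induction k, hk using Nat.le_induction with
  | base =>
    refine ⟨1, le_rfl, le_rfl, ?_⟩
    rw [hd 1 le_rfl]
    simpa [hd0, ha] using hserve 1 le_rfl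
  | succ k hk ih =>
    have hs := hserve (k + 1) (by omega)
    rw [hd (k + 1) (by omega), Nat.add_sub_cancel]
    rcases le_total (d k) (a (k + 1)) with h | h
    · refine ⟨k + 1, by omega, le_rfl, ?_⟩
      simpa [max_eq_left h] using hs
    · obtain ⟨i, hi, hik, hle⟩ := ih
      refine ⟨i, hi, by omega, ?_⟩
      rw [max_eq_right h, Finset.sum_Ico_succ_top (by omega), add_div]
      linarith

/-- Corollary 2 (direct backlog bound): if `∑ n, r n ≤ Cmin`, the backlog at
any time `t` is bounded by `∑ n, σ n + (∑ n, r n) * L / Cmin`. -/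
theorem multiclass_fifo_direct_backlog_bound
    (N : ℕ) (hN : 0 < N)
    (C : Fin N → ℝ) (hC : ∀ n, 0 < C n)
    (Cmin : ℝ) (hCmin : IsLeast (Set.range C) Cmin)
    (a l : ℕ → ℝ) (c : ℕ → Fin N)
    (ha0 : ∀ j, 0 ≤ a j) (hamono : Monotone a)
    (hl : ∀ j, 1 ≤ j → 0 < l j)
    (L : ℝ) (hL : 0 < L) (hlen : ∀ j, 1 ≤ j → l j ≤ L)
    (hfin : ∀ t : ℝ, {j : ℕ | a j ≤ t}.Finite)
    (d : ℕ → ℝ) (hd0 : d 0 = 0)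
    (hd : ∀ j, 1 ≤ j → d j = max (a j) (d (j - 1)) + l j / C (c j))
    (A Astar : ℝ → ℝ)
    (hA : ∀ t, A t = ∑' j : ℕ, if 1 ≤ j ∧ a j ≤ t then l j else 0)
    (hAstar : ∀ t, Astar t = ∑' j : ℕ, if 1 ≤ j ∧ d j ≤ t then l j else 0)
    (r σ : Fin N → ℝ) (hr : ∀ n, 0 ≤ r n) (hσ : ∀ n, 0 ≤ σ n)
    (harr : ∀ n : Fin N, ∀ s t : ℝ, 0 ≤ s → s ≤ t →
      (∑' j : ℕ, if 1 ≤ j ∧ c j = n ∧ s ≤ a j ∧ a j ≤ t then l j else 0)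
        ≤ r n * (t - s) + σ n)
    (hcond : ∑ n, r n ≤ Cmin) :
    ∀ t : ℝ, A t - Astar t ≤ ∑ n, σ n + (∑ n, r n) * (L / Cmin) := by
  intro t
  have hCmin0 : 0 < Cmin := by
    obtain ⟨n, hn⟩ := hCmin.1
    exact hn ▸ hC n
  have hCle : ∀ n, Cmin ≤ C n := fun n => hCmin.2 ⟨n, rfl⟩
  have hR : 0 ≤ ∑ n, r n := Finset.sum_nonneg fun n _ => hr n
  have had : ∀ j, 1 ≤ j → a j ≤ d j := fun j hj => by
    rw [hd j hj]
    have := div_pos (hl j hj) (hC (c j))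
    linarith [le_max_left (a j) (d (j - 1))]
  set F := (hfin t).toFinset with hF
  have hmem : ∀ j, j ∈ F ↔ a j ≤ t := fun j => by simp [hF]
  have htsum : ∀ (p : ℕ → Prop) [DecidablePred p], (∀ j, p j → a j ≤ t) →
      (∑' j, if p j then l j else 0) = ∑ j ∈ F, if p j then l j else 0 := fun p _ hp =>
    tsum_eq_sum fun j hj => if_neg fun h => hj ((hmem j).2 (hp j h))
  have hback : A t - Astar t = ∑ j ∈ F, if 1 ≤ j ∧ t < d j then l j else 0 := by
    rw [hA, hAstar, htsum (fun j => 1 ≤ j ∧ a j ≤ t) fun j h => h.2,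
      htsum (fun j => 1 ≤ j ∧ d j ≤ t) fun j h => (had j h.1).trans h.2,
      ← Finset.sum_sub_distrib]
    refine Finset.sum_congr rfl fun j hj => ?_
    have := (hmem j).1 hj
    by_cases h1 : 1 ≤ j <;> by_cases h2 : d j ≤ t <;> simp [h1, h2, this, not_lt.2, not_le.1]
  rw [hback]
  by_cases hex : ∃ j, a j ≤ t ∧ 1 ≤ j ∧ t < d j
  · obtain ⟨j₀, hj₀, hj₀d⟩ := hex
    have hex' : ∃ j, 1 ≤ j ∧ t < d j := ⟨j₀, hj₀d⟩
    obtain ⟨k, ⟨hk, hkd⟩, hmin⟩ : ∃ k, (1 ≤ k ∧ t < d k) ∧ ∀ j, 1 ≤ j ∧ t < d j → k ≤ j :=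
      ⟨Nat.find hex', Nat.find_spec hex', fun j hj => Nat.find_min' hex' hj⟩
    have hak : a k ≤ t := (hamono (hmin j₀ hj₀d)).trans hj₀
    obtain ⟨i, hi, hik, hdk⟩ := exists_departure_le_arrival_add_sum_div (w := fun j => C (c j))
      hCmin0 (fun j _ => hCle (c j)) (ha0 1) hl hd0 hd k hk
    have hai : a i ≤ t := (hamono hik).trans hak
    have harrival : (∑ j ∈ F, if 1 ≤ j ∧ a i ≤ a j then l j else 0)
        ≤ (∑ n, r n) * (t - a i) + ∑ n, σ n := by
      rw [Finset.sum_mul, ← Finset.sum_add_distrib]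
      refine le_of_eq_of_le ?_ (Finset.sum_le_sum fun n _ => harr n (a i) t (ha0 i) hai)
      rw [Finset.sum_congr rfl fun n _ =>
        htsum (fun j => 1 ≤ j ∧ c j = n ∧ a i ≤ a j ∧ a j ≤ t) fun j h => h.2.2.2, Finset.sum_comm]
      refine Finset.sum_congr rfl fun j hj => ?_
      have := (hmem j).1 hj
      by_cases h : 1 ≤ j ∧ a i ≤ a j
      · simp [h, this]
      · rw [if_neg h]
        exact (Finset.sum_eq_zero fun n _ => if_neg fun h' => h ⟨h'.1, h'.2.2.1⟩).symm
    have hserved : ∑ j ∈ Finset.Ico i k, l j = ∑ j ∈ F, if j ∈ Finset.Ico i k then l j else 0 := by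
      rw [← Finset.sum_filter]
      refine Finset.sum_congr ?_ fun _ _ => rfl
      ext j
      simp only [Finset.mem_filter, hmem, iff_and_self, Finset.mem_Ico]
      exact fun h => (hamono h.2.le).trans hak
    have hsplit : (∑ j ∈ F, if 1 ≤ j ∧ t < d j then l j else 0) + ∑ j ∈ Finset.Ico i k, l j
        ≤ ∑ j ∈ F, if 1 ≤ j ∧ a i ≤ a j then l j else 0 := by
      rw [hserved, ← Finset.sum_add_distrib]
      refine Finset.sum_le_sum fun j _ => ?_
      by_cases h1 : 1 ≤ j ∧ t < d j
      · have hkj := hmin j h1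
        have haij := hamono (hik.trans hkj)
        simp [h1, haij, hkj.not_gt]
      · rw [if_neg h1, zero_add]
        by_cases h2 : j ∈ Finset.Ico i k
        · have hij := (Finset.mem_Ico.1 h2).1
          rw [if_pos h2, if_pos ⟨hi.trans hij, hamono hij⟩]
        · rw [if_neg h2]
          split_ifs with h3
          · exact (hl j h3.1).le
          · exact le_rfl
    have hD : 0 ≤ ∑ j ∈ Finset.Ico i k, l j :=
      Finset.sum_nonneg fun j hj => (hl j (hi.trans (Finset.mem_Ico.1 hj).1)).le
    rw [Finset.sum_Ico_succ_top hik, add_div] at hdk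
    have hlk : l k / Cmin ≤ L / Cmin := div_le_div_of_nonneg_right (hlen k hk) hCmin0.le
    set D := ∑ j ∈ Finset.Ico i k, l j
    have hrate : (∑ n, r n) * (D / Cmin) ≤ D :=
      (mul_le_mul_of_nonneg_right hcond (div_nonneg hD hCmin0.le)).trans_eq
        (mul_div_cancel₀ D hCmin0.ne')
    have htime : (∑ n, r n) * (t - a i) ≤ (∑ n, r n) * (D / Cmin + L / Cmin) :=
      mul_le_mul_of_nonneg_left (by linarith) hR
    linarith
  · rw [Finset.sum_eq_zero fun j hj => if_neg fun h => hex ⟨j, (hmem j).1 hj, h⟩]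
    have := Finset.sum_nonneg fun n (_ : n ∈ Finset.univ) => hσ n
    positivity
end

section
/- (Corollary 3, direct per-class guaranteed rate) Fix a class n. If Σ_{m ≠ n} r_m < C_min, then the multiclass FIFO system is a Guaranteed Rate server to class n with rate R_n = C_min − Σ_{m ≠ n} r_m and error term E_n = (Σ_{m ≠ n} σ_m + L)/(C_min − Σ_{m ≠ n} r_m); that is, every class-n packet i satisfies d^{n}(i) ≤ GRC^{n}_i(R_n) + E_n, where GRC^{n} is the guaranteed-rate clock of the class-n subsequence of packets. -/
open scoped Classical BigOperators

/-- In a FIFO recursion, the departure time of packet `p` is determined by the packet `k`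
that starts its busy period. -/
lemma exists_busy_period_start {a w d : ℕ → ℝ} (ha0 : ∀ j, 0 ≤ a j) (hd0 : d 0 = 0)
    (hd : ∀ j, 1 ≤ j → d j = max (a j) (d (j - 1)) + w j) {p : ℕ} (hp : 1 ≤ p) :
    ∃ k, 1 ≤ k ∧ k ≤ p ∧ d p = a k + ∑ j ∈ Finset.Icc k p, w j := by
  induction p, hp using Nat.le_induction with
  | base => exact ⟨1, le_rfl, le_rfl, by simp [hd 1 le_rfl, hd0, ha0 1]⟩
  | succ p hp ih =>
    have h := hd (p + 1) (by omega)
    rw [Nat.add_sub_cancel] at h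
    rcases le_total (d p) (a (p + 1)) with hle | hle
    · exact ⟨p + 1, by omega, le_rfl, by rw [h, max_eq_left hle]; simp⟩
    · obtain ⟨k, hk1, hkp, hk⟩ := ih
      refine ⟨k, hk1, by omega, ?_⟩
      rw [h, max_eq_right hle, hk, Finset.sum_Icc_succ_top (by omega), add_assoc]

/-- The guaranteed-rate clock of a subsequence dominates the arrival time of any earlier packet
`k` plus the service time, at the guaranteed rate, of the packets of the subsequence since `k`. -/
lemma arrival_add_sum_le_clock {a v G : ℕ → ℝ} {P : ℕ → Prop} [DecidablePred P] {idx : ℕ → ℕ}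
    (hamono : Monotone a) (hidx : StrictMono idx)
    (hP : ∀ i, 1 ≤ i → P (idx i)) (hsurj : ∀ j, 1 ≤ j → P j → ∃ i, 1 ≤ i ∧ idx i = j)
    (hG : ∀ i, 1 ≤ i → G i = max (a (idx i)) (G (i - 1)) + v (idx i))
    {k : ℕ} (hk : 1 ≤ k) {i : ℕ} (hi : 1 ≤ i) (hki : k ≤ idx i) :
    a k + ∑ j ∈ Finset.Icc k (idx i) with P j, v j ≤ G i := by
  induction i with
  | zero => omega
  | succ i ih =>
    have h := hG (i + 1) hi
    rw [Nat.add_sub_cancel] at h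
    have hlt : idx i < idx (i + 1) := hidx i.lt_succ_self
    by_cases hprev : 1 ≤ i ∧ k ≤ idx i
    · have hset : (Finset.Icc k (idx (i + 1))).filter P
          = insert (idx (i + 1)) ((Finset.Icc k (idx i)).filter P) := by
        ext j
        simp only [Finset.mem_filter, Finset.mem_Icc, Finset.mem_insert]
        constructor
        · rintro ⟨⟨hkj, hji⟩, hj⟩
          obtain ⟨i', -, rfl⟩ := hsurj j (hk.trans hkj) hj
          rcases (hidx.le_iff_le.1 hji).lt_or_eq with hlt' | rfl
          · exact Or.inr ⟨⟨hkj, hidx.monotone (Nat.lt_succ_iff.1 hlt')⟩, hj⟩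
          · exact Or.inl rfl
        · rintro (rfl | ⟨⟨hkj, hji⟩, hj⟩)
          · exact ⟨⟨hki, le_rfl⟩, hP _ hi⟩
          · exact ⟨⟨hkj, by omega⟩, hj⟩
      rw [hset, Finset.sum_insert (by simp [hlt]), h]
      linarith [ih hprev.1 hprev.2, le_max_right (a (idx (i + 1))) (G i)]
    · have hset : (Finset.Icc k (idx (i + 1))).filter P = {idx (i + 1)} := by
        ext j
        simp only [Finset.mem_filter, Finset.mem_Icc, Finset.mem_singleton]
        constructor
        · rintro ⟨⟨hkj, hji⟩, hj⟩
          obtain ⟨i', hi', rfl⟩ := hsurj j (hk.trans hkj) hj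
          rcases (hidx.le_iff_le.1 hji).lt_or_eq with hlt' | rfl
          · have hle : i' ≤ i := Nat.lt_succ_iff.1 hlt'
            exact absurd ⟨hi'.trans hle, hkj.trans (hidx.monotone hle)⟩ hprev
          · rfl
        · rintro rfl
          exact ⟨⟨hki, le_rfl⟩, hP _ hi⟩
      rw [hset, Finset.sum_singleton, h]
      linarith [hamono hki, le_max_left (a (idx (i + 1))) (G i)]

/-- The class-`m` packets among `k, …, p` are counted by the cumulative class-`m` arrival in
`[a k, a p]`. -/
lemma sum_class_le_tsum_arrival {ι : Type*} [DecidableEq ι] {a l : ℕ → ℝ} {c : ℕ → ι}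
    (hamono : Monotone a) (hl : ∀ j, 1 ≤ j → 0 < l j)
    (hfin : ∀ t : ℝ, {j : ℕ | a j ≤ t}.Finite) (m : ι) {k p : ℕ} (hk : 1 ≤ k) :
    ∑ j ∈ Finset.Icc k p with c j = m, l j
      ≤ ∑' j : ℕ, if 1 ≤ j ∧ c j = m ∧ a k ≤ a j ∧ a j ≤ a p then l j else 0 := by
  have hsum : Summable fun j : ℕ =>
      if 1 ≤ j ∧ c j = m ∧ a k ≤ a j ∧ a j ≤ a p then l j else 0 := by
    refine summable_of_hasFiniteSupport ((hfin (a p)).subset fun j hj => ?_)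
    by_contra hlt
    exact hj (if_neg fun h => hlt h.2.2.2)
  refine le_trans (Finset.sum_le_sum fun j hj => ?_)
    (hsum.sum_le_tsum ((Finset.Icc k p).filter fun j => c j = m) fun j _ => ?_)
  · simp only [Finset.mem_filter, Finset.mem_Icc] at hj
    rw [if_pos ⟨hk.trans hj.1.1, hj.2, hamono hj.1.1, hamono hj.1.2⟩]
  · split_ifs with h
    · exact (hl j h.1).le
    · exact le_rfl

/-- Corollary 3 (direct per-class guaranteed rate): if `∑_{m ≠ n} r m < Cmin`,
the multiclass FIFO system is a GR server to class `n` with rate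
`Cmin - ∑_{m ≠ n} r m` and error term
`(∑_{m ≠ n} σ m + L) / (Cmin - ∑_{m ≠ n} r m)`.  The class-`n` flow is
enumerated by the strictly increasing map `idx`. -/
theorem multiclass_fifo_direct_per_class_GR
    (N : ℕ) (hN : 0 < N)
    (C : Fin N → ℝ) (hC : ∀ n, 0 < C n)
    (Cmin : ℝ) (hCmin : IsLeast (Set.range C) Cmin)
    (a l : ℕ → ℝ) (c : ℕ → Fin N)
    (ha0 : ∀ j, 0 ≤ a j) (hamono : Monotone a)
    (hl : ∀ j, 1 ≤ j → 0 < l j)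
    (L : ℝ) (hL : 0 < L) (hlen : ∀ j, 1 ≤ j → l j ≤ L)
    (hfin : ∀ t : ℝ, {j : ℕ | a j ≤ t}.Finite)
    (d : ℕ → ℝ) (hd0 : d 0 = 0)
    (hd : ∀ j, 1 ≤ j → d j = max (a j) (d (j - 1)) + l j / C (c j))
    (r σ : Fin N → ℝ) (hr : ∀ m, 0 ≤ r m) (hσ : ∀ m, 0 ≤ σ m)
    (harr : ∀ m : Fin N, ∀ s t : ℝ, 0 ≤ s → s ≤ t →
      (∑' j : ℕ, if 1 ≤ j ∧ c j = m ∧ s ≤ a j ∧ a j ≤ t then l j else 0)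
        ≤ r m * (t - s) + σ m)
    (n : Fin N)
    (idx : ℕ → ℕ) (hidx_mono : StrictMono idx)
    (hidx_class : ∀ i, 1 ≤ i → 1 ≤ idx i ∧ c (idx i) = n)
    (hidx_surj : ∀ j, 1 ≤ j → c j = n → ∃ i, 1 ≤ i ∧ idx i = j)
    (GRCn : ℕ → ℝ) (hG0 : GRCn 0 = 0)
    (hG : ∀ i, 1 ≤ i → GRCn i = max (a (idx i)) (GRCn (i - 1))
      + l (idx i) / (Cmin - ∑ m ∈ Finset.univ.erase n, r m))
    (hcond : ∑ m ∈ Finset.univ.erase n, r m < Cmin) :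
    ∀ i, 1 ≤ i → d (idx i) ≤ GRCn i
      + (∑ m ∈ Finset.univ.erase n, σ m + L)
          / (Cmin - ∑ m ∈ Finset.univ.erase n, r m) := by
  intro i hi
  set ρ := ∑ m ∈ Finset.univ.erase n, r m
  set S := ∑ m ∈ Finset.univ.erase n, σ m
  set p := idx i
  have hR : 0 < Cmin - ρ := sub_pos.2 hcond
  have hCmin0 : 0 < Cmin := by
    obtain ⟨m, rfl⟩ := hCmin.1
    exact hC m
  have hp : 1 ≤ p := (hidx_class i hi).1
  obtain ⟨k, hk, hkp, hdp⟩ := exists_busy_period_start (w := fun j => l j / C (c j)) ha0 hd0 hd hp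
  have hclock := arrival_add_sum_le_clock (v := fun j => l j / (Cmin - ρ)) (P := fun j => c j = n)
    hamono hidx_mono (fun i hi => (hidx_class i hi).2) hidx_surj hG hk hi hkp
  rw [← Finset.sum_div] at hclock
  set Q := ∑ j ∈ Finset.Icc k (idx i) with c j = n, l j
  have harrival : a p ≤ d p := by
    rw [hd p hp]
    have := div_pos (hl p hp) (hC (c p))
    linarith [le_max_left (a p) (d (p - 1))]
  have hservice : d p - a k ≤ (∑ j ∈ Finset.Icc k p, l j) / Cmin := by
    rw [hdp, add_sub_cancel_left, Finset.sum_div]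
    refine Finset.sum_le_sum fun j hj => ?_
    exact div_le_div_of_nonneg_left (hl j (hk.trans (Finset.mem_Icc.1 hj).1)).le hCmin0
      (hCmin.2 ⟨c j, rfl⟩)
  have hcross : ∑ m ∈ Finset.univ.erase n, ∑ j ∈ Finset.Icc k p with c j = m, l j
      ≤ ρ * (a p - a k) + S := by
    rw [Finset.sum_mul, ← Finset.sum_add_distrib]
    exact Finset.sum_le_sum fun m _ =>
      (sum_class_le_tsum_arrival (c := c) hamono hl hfin m hk).trans (harr m _ _ (ha0 k) (hamono hkp))
  have hsplit : ∑ j ∈ Finset.Icc k p, l j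
      = Q + ∑ m ∈ Finset.univ.erase n, ∑ j ∈ Finset.Icc k p with c j = m, l j := by
    rw [← Finset.sum_fiberwise (Finset.Icc k p) c l]
    exact (Finset.add_sum_erase _ _ (Finset.mem_univ n)).symm
  have hρ : 0 ≤ ρ := Finset.sum_nonneg fun m _ => hr m
  have hdelay : d p - a k ≤ (Q + S) / (Cmin - ρ) := by
    rw [le_div_iff₀ hCmin0, hsplit] at hservice
    rw [le_div_iff₀ hR]
    linarith [mul_le_mul_of_nonneg_left (sub_le_sub_right harrival (a k)) hρ]
  have hLR : 0 < L / (Cmin - ρ) := div_pos hL hR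
  rw [add_div] at hdelay ⊢
  linarith
end

section
/- (Theorem 2, improved backlog bound) If ρ = Σ_n r_n/C(n) ≤ 1, then the backlog at any time t satisfies B(t) = A(t) − A*(t) ≤ min{ (Σ_n r_n)·(Σ_n σ_n/C(n)) + Σ_n σ_n , C_max·(Σ_n σ_n/C(n)) + ρ·C_max·max_n (L_n/C(n)) }. -/
open scoped Classical BigOperators

/-- A finite set of packets arriving in `[s, t]`, with class weights `w`, has weighted volume at most
the weighted sum of the leaky-bucket bounds. -/
theorem sum_weighted_length_le {N : ℕ} {a l : ℕ → ℝ} {c : ℕ → Fin N} {r σ w : Fin N → ℝ}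
    (hl : ∀ j, 1 ≤ j → 0 < l j) (hfin : ∀ t : ℝ, {j : ℕ | a j ≤ t}.Finite)
    (harr : ∀ n : Fin N, ∀ s t : ℝ, 0 ≤ s → s ≤ t →
      (∑' j : ℕ, if 1 ≤ j ∧ c j = n ∧ s ≤ a j ∧ a j ≤ t then l j else 0)
        ≤ r n * (t - s) + σ n)
    (hw : ∀ n, 0 ≤ w n) {s t : ℝ} (hs : 0 ≤ s) (hst : s ≤ t) (S : Finset ℕ)
    (hS : ∀ j ∈ S, 1 ≤ j ∧ s ≤ a j ∧ a j ≤ t) :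
    ∑ j ∈ S, w (c j) * l j ≤ ∑ n, w n * (r n * (t - s) + σ n) := by
  rw [← Finset.sum_fiberwise S c]
  refine Finset.sum_le_sum fun n _ => ?_
  have hsum : Summable fun j : ℕ =>
      if 1 ≤ j ∧ c j = n ∧ s ≤ a j ∧ a j ≤ t then l j else 0 := by
    refine summable_of_hasFiniteSupport ((hfin t).subset fun j hj => ?_)
    by_contra h
    exact hj (if_neg fun h' => h h'.2.2.2)
  have hfiber : ∑ j ∈ S with c j = n, w (c j) * l j =
      w n * ∑ j ∈ S with c j = n,
        if 1 ≤ j ∧ c j = n ∧ s ≤ a j ∧ a j ≤ t then l j else 0 := by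
    rw [Finset.mul_sum]
    refine Finset.sum_congr rfl fun j hj => ?_
    obtain ⟨hjS, hjn⟩ := Finset.mem_filter.1 hj
    obtain ⟨h1, h2, h3⟩ := hS j hjS
    rw [if_pos ⟨h1, hjn, h2, h3⟩, hjn]
  rw [hfiber]
  refine mul_le_mul_of_nonneg_left ((hsum.sum_le_tsum _ fun j _ => ?_).trans
    (harr n s t hs hst)) (hw n)
  split_ifs with h
  · exact (hl j h.1).le
  · exact le_rfl

/-- Every departure time is the arrival time of the packet that started the busy period plus the
service times of the packets served since then. -/
theorem exists_busyPeriod_start {a d x : ℕ → ℝ} (ha0 : ∀ j, 0 ≤ a j) (hd0 : d 0 = 0)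
    (hd : ∀ j, 1 ≤ j → d j = max (a j) (d (j - 1)) + x j) :
    ∀ p, 1 ≤ p → ∃ k, 1 ≤ k ∧ k ≤ p ∧ d p = a k + ∑ j ∈ Finset.Ico k p, x j + x p := by
  intro p hp
  induction p, hp using Nat.le_induction with
  | base => exact ⟨1, le_rfl, le_rfl, by simp [hd 1 le_rfl, hd0, ha0 1]⟩
  | succ p hp ih =>
    rcases le_total (d p) (a (p + 1)) with h | h
    · exact ⟨p + 1, by omega, le_rfl, by simp [hd (p + 1), h]⟩
    · obtain ⟨k, hk1, hkp, hk⟩ := ih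
      refine ⟨k, hk1, by omega, ?_⟩
      rw [hd (p + 1) (by omega), Nat.add_sub_cancel, max_eq_right h, hk,
        Finset.sum_Ico_succ_top hkp]
      ring

/-- The backlog at time `t` is the total length of a finite set of packets, namely those that have
arrived but not departed. -/
theorem exists_finset_backlog_eq {a l d : ℕ → ℝ} (hfin : ∀ t : ℝ, {j : ℕ | a j ≤ t}.Finite)
    (had : ∀ j, 1 ≤ j → a j ≤ d j) (t : ℝ) :
    ∃ S : Finset ℕ, (∀ j ∈ S, 1 ≤ j ∧ a j ≤ t ∧ t < d j) ∧
      (∑' j : ℕ, if 1 ≤ j ∧ a j ≤ t then l j else 0) -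
        (∑' j : ℕ, if 1 ≤ j ∧ d j ≤ t then l j else 0) = ∑ j ∈ S, l j := by
  refine ⟨{j ∈ (hfin t).toFinset | 1 ≤ j ∧ t < d j}, fun j hj => ?_, ?_⟩
  · simp only [Finset.mem_filter, Set.Finite.mem_toFinset, Set.mem_ofPred_eq] at hj
    exact ⟨hj.2.1, hj.1, hj.2.2⟩
  · rw [tsum_eq_sum (s := (hfin t).toFinset), tsum_eq_sum (s := (hfin t).toFinset),
      ← Finset.sum_sub_distrib, Finset.sum_filter]
    · refine Finset.sum_congr rfl fun j hj => ?_
      have hj' : a j ≤ t := by simpa using hj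
      by_cases h1 : 1 ≤ j
      · rcases le_or_gt (d j) t with h | h
        · simp [h1, hj', h, h.not_gt]
        · simp [h1, hj', h, h.not_ge]
      · simp [h1]
    · intro j hj
      have hj' : ¬ a j ≤ t := by simpa using hj
      exact if_neg fun h => hj' ((had j h.1).trans h.2)
    · intro j hj
      have hj' : ¬ a j ≤ t := by simpa using hj
      exact if_neg fun h => hj' h.2

/-- Theorem 2 (improved backlog bound): if `ρ = ∑ n, r n / C n ≤ 1`, the
backlog at any time is bounded by the minimum of the two stated expressions. -/
theorem multiclass_fifo_improved_backlog_bound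
    (N : ℕ) (hN : 0 < N)
    (C : Fin N → ℝ) (hC : ∀ n, 0 < C n)
    (Cmax : ℝ) (hCmax : IsGreatest (Set.range C) Cmax)
    (a l : ℕ → ℝ) (c : ℕ → Fin N)
    (ha0 : ∀ j, 0 ≤ a j) (hamono : Monotone a)
    (hl : ∀ j, 1 ≤ j → 0 < l j)
    (L : Fin N → ℝ) (hL : ∀ n, 0 < L n)
    (hlen : ∀ j, 1 ≤ j → l j ≤ L (c j))
    (maxLC : ℝ) (hmaxLC : IsGreatest (Set.range fun n => L n / C n) maxLC)
    (hfin : ∀ t : ℝ, {j : ℕ | a j ≤ t}.Finite)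
    (d : ℕ → ℝ) (hd0 : d 0 = 0)
    (hd : ∀ j, 1 ≤ j → d j = max (a j) (d (j - 1)) + l j / C (c j))
    (A Astar : ℝ → ℝ)
    (hA : ∀ t, A t = ∑' j : ℕ, if 1 ≤ j ∧ a j ≤ t then l j else 0)
    (hAstar : ∀ t, Astar t = ∑' j : ℕ, if 1 ≤ j ∧ d j ≤ t then l j else 0)
    (r σ : Fin N → ℝ) (hr : ∀ n, 0 ≤ r n) (hσ : ∀ n, 0 ≤ σ n)
    (harr : ∀ n : Fin N, ∀ s t : ℝ, 0 ≤ s → s ≤ t →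
      (∑' j : ℕ, if 1 ≤ j ∧ c j = n ∧ s ≤ a j ∧ a j ≤ t then l j else 0)
        ≤ r n * (t - s) + σ n)
    (hρ : ∑ n, r n / C n ≤ 1) :
    ∀ t : ℝ, A t - Astar t ≤
      min ((∑ n, r n) * (∑ n, σ n / C n) + ∑ n, σ n)
        (Cmax * (∑ n, σ n / C n) + (∑ n, r n / C n) * Cmax * maxLC) := by
  intro t
  have hx : ∀ j, 1 ≤ j → 0 < l j / C (c j) := fun j hj => div_pos (hl j hj) (hC _)
  have had : ∀ j, 1 ≤ j → a j ≤ d j := fun j hj => by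
    rw [hd j hj]
    linarith [le_max_left (a j) (d (j - 1)), hx j hj]
  have hCmax0 : 0 < Cmax := (hC _).trans_le (hCmax.2 ⟨⟨0, hN⟩, rfl⟩)
  have hmaxLC0 : 0 < maxLC := (div_pos (hL _) (hC _)).trans_le (hmaxLC.2 ⟨⟨0, hN⟩, rfl⟩)
  have hD0 : 0 ≤ ∑ n, σ n / C n := Finset.sum_nonneg fun n _ => div_nonneg (hσ n) (hC n).le
  have hρ0 : 0 ≤ ∑ n, r n / C n := Finset.sum_nonneg fun n _ => div_nonneg (hr n) (hC n).le
  have hR0 : 0 ≤ ∑ n, r n := Finset.sum_nonneg fun n _ => hr n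
  have hσ0 : 0 ≤ ∑ n, σ n := Finset.sum_nonneg fun n _ => hσ n
  obtain ⟨S, hS, hSsum⟩ := exists_finset_backlog_eq (l := l) hfin had t
  rw [hA, hAstar, hSsum]
  rcases S.eq_empty_or_nonempty with rfl | hne
  · rw [Finset.sum_empty]
    exact le_min (by positivity) (by positivity)
  have hvolume {s u : ℝ} (hs : 0 ≤ s) (hsu : s ≤ u) (T : Finset ℕ)
      (hT : ∀ j ∈ T, 1 ≤ j ∧ s ≤ a j ∧ a j ≤ u) :
      ∑ j ∈ T, l j ≤ (∑ n, r n) * (u - s) + ∑ n, σ n := by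
    have h := sum_weighted_length_le (w := fun _ => 1) hl hfin harr (fun _ => zero_le_one) hs hsu T hT
    simpa [Finset.sum_add_distrib, Finset.sum_mul] using h
  have hwork {s u : ℝ} (hs : 0 ≤ s) (hsu : s ≤ u) (T : Finset ℕ)
      (hT : ∀ j ∈ T, 1 ≤ j ∧ s ≤ a j ∧ a j ≤ u) :
      ∑ j ∈ T, l j / C (c j) ≤ (∑ n, r n / C n) * (u - s) + ∑ n, σ n / C n := by
    have h := sum_weighted_length_le (w := fun n => (C n)⁻¹) hl hfin harr
      (fun n => (inv_pos.2 (hC n)).le) hs hsu T hT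
    convert h using 1
    · exact Finset.sum_congr rfl fun j _ => div_eq_inv_mul _ _
    · rw [Finset.sum_mul, ← Finset.sum_add_distrib]
      exact Finset.sum_congr rfl fun n _ => by ring
  obtain ⟨p, hpS, hpmin⟩ := S.exists_min_image id hne
  simp only [id] at hpmin
  obtain ⟨hp1, hapt, htdp⟩ := hS p hpS
  obtain ⟨k, hk1, hkp, hk⟩ := exists_busyPeriod_start ha0 hd0 hd p hp1
  have hakp : a k ≤ a p := hamono hkp
  have hxnonneg : 0 ≤ ∑ j ∈ Finset.Ico k p, l j / C (c j) :=
    Finset.sum_nonneg fun j hj => (hx j (hk1.trans (Finset.mem_Ico.1 hj).1)).le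
  refine le_min ?_ ?_
  · have hbusy := hwork (ha0 k) hakp (Finset.Ico k (p + 1)) fun j hj => by
      have hj' := Finset.mem_Ico.1 hj
      exact ⟨hk1.trans hj'.1, hamono hj'.1, hamono (by omega)⟩
    rw [Finset.sum_Ico_succ_top hkp] at hbusy
    have hdelay : t - a p ≤ ∑ n, σ n / C n := by
      linarith [mul_le_of_le_one_left (sub_nonneg.2 hakp) hρ]
    have hback := hvolume (ha0 p) hapt S fun j hj =>
      ⟨(hS j hj).1, hamono (hpmin j hj), (hS j hj).2.1⟩
    linarith [mul_le_mul_of_nonneg_left hdelay hR0]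
  · have hdisj : Disjoint (Finset.Ico k p) S := Finset.disjoint_left.2 fun j hj hjS => by
      have h₁ := (Finset.mem_Ico.1 hj).2
      have h₂ := hpmin j hjS
      omega
    have hbusy := hwork (ha0 k) (hakp.trans hapt) (Finset.Ico k p ∪ S) fun j hj => by
      rcases Finset.mem_union.1 hj with hj | hj
      · have hj' := Finset.mem_Ico.1 hj
        exact ⟨hk1.trans hj'.1, hamono hj'.1, (hamono hj'.2.le).trans hapt⟩
      · exact ⟨(hS j hj).1, hamono (hkp.trans (hpmin j hj)), (hS j hj).2.1⟩
    rw [Finset.sum_union hdisj] at hbusy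
    have hxp : l p / C (c p) ≤ maxLC :=
      (div_le_div_of_nonneg_right (hlen p hp1) (hC _).le).trans (hmaxLC.2 ⟨c p, rfl⟩)
    have hback : ∑ j ∈ S, l j / C (c j) ≤ (∑ n, r n / C n) * maxLC + ∑ n, σ n / C n := by
      have helapsed : t - a k ≤ ∑ j ∈ Finset.Ico k p, l j / C (c j) + maxLC := by linarith
      linarith [mul_le_mul_of_nonneg_left helapsed hρ0, mul_le_of_le_one_left hxnonneg hρ]
    calc ∑ j ∈ S, l j ≤ ∑ j ∈ S, Cmax * (l j / C (c j)) :=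
          Finset.sum_le_sum fun j hj => by
            rw [← mul_div_assoc, le_div_iff₀ (hC _), mul_comm]
            exact mul_le_mul_of_nonneg_right (hCmax.2 ⟨c j, rfl⟩) (hl j (hS j hj).1).le
      _ = Cmax * ∑ j ∈ S, l j / C (c j) := (Finset.mul_sum ..).symm
      _ ≤ Cmax * ((∑ n, r n / C n) * maxLC + ∑ n, σ n / C n) :=
          mul_le_mul_of_nonneg_left hback hCmax0.le
      _ = _ := by ring
end

section
/- (Comparison of service curves, Section 4.3) Fix a class n. If Σ_{m ≠ n} r_m < C_min, then the service curve of Theorem 4 dominates that of Corollary 4 pointwise: for all t ≥ 0, max( (1 − Σ_{m ≠ n} r_m/C(m))·C(n)·t − L_n − C(n)·Σ_{m ≠ n} σ_m/C(m), 0 ) ≥ max( (C_min − Σ_{m ≠ n} r_m)·t − L − Σ_{m ≠ n} σ_m, 0 ). -/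
open scoped Classical BigOperators

/-- Dividing termwise by numbers bounded below by `c` shrinks a nonnegative sum by at least `c`. -/
theorem mul_sum_div_le_sum {ι : Type*} (s : Finset ι) (C x : ι → ℝ) (c : ℝ)
    (hC : ∀ m, 0 < C m) (hc : ∀ m, c ≤ C m) (hx : ∀ m, 0 ≤ x m) :
    c * ∑ m ∈ s, x m / C m ≤ ∑ m ∈ s, x m := by
  rw [Finset.mul_sum]
  refine Finset.sum_le_sum fun m _ => ?_
  rw [← mul_div_assoc, div_le_iff₀ (hC m), mul_comm]
  exact mul_le_mul_of_nonneg_left (hc m) (hx m)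

/-- Comparison of service curves (Section 4.3): if `∑_{m ≠ n} r m < Cmin`,
the service curve of Theorem 4 dominates that of Corollary 4 pointwise. -/
theorem service_curve_comparison
    (N : ℕ) (hN : 0 < N)
    (C : Fin N → ℝ) (hC : ∀ n, 0 < C n)
    (Cmin : ℝ) (hCmin : IsLeast (Set.range C) Cmin)
    (r σ : Fin N → ℝ) (hr : ∀ m, 0 ≤ r m) (hσ : ∀ m, 0 ≤ σ m)
    (L : Fin N → ℝ) (hL : ∀ m, 0 < L m)
    (Lmax : ℝ) (hLmax : IsGreatest (Set.range L) Lmax)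
    (n : Fin N)
    (hcond : ∑ m ∈ Finset.univ.erase n, r m < Cmin) :
    ∀ t : ℝ, 0 ≤ t →
      max ((1 - ∑ m ∈ Finset.univ.erase n, r m / C m) * C n * t
          - L n - C n * ∑ m ∈ Finset.univ.erase n, σ m / C m) 0 ≥
      max ((Cmin - ∑ m ∈ Finset.univ.erase n, r m) * t
          - Lmax - ∑ m ∈ Finset.univ.erase n, σ m) 0 := by
  intro t ht
  have hle : ∀ m, Cmin ≤ C m := fun m => hCmin.2 ⟨m, rfl⟩
  have hpos : 0 < Cmin := by
    obtain ⟨k, hk⟩ := hCmin.1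
    exact hk ▸ hC k
  have hLn : L n ≤ Lmax := hLmax.2 ⟨n, rfl⟩
  have hLn_pos := hL n
  have hA := mul_sum_div_le_sum (Finset.univ.erase n) C r Cmin hC hle hr
  have hB := mul_sum_div_le_sum (Finset.univ.erase n) C σ Cmin hC hle hσ
  set A := ∑ m ∈ Finset.univ.erase n, r m / C m
  set B := ∑ m ∈ Finset.univ.erase n, σ m / C m
  set R := ∑ m ∈ Finset.univ.erase n, r m
  set S := ∑ m ∈ Finset.univ.erase n, σ m
  refine max_le ?_ (le_max_right _ _)
  rcases le_total ((Cmin - R) * t - Lmax - S) 0 with h | h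
  · exact h.trans (le_max_right _ _)
  · refine le_trans ?_ (le_max_left _ _)
    have hX : (Cmin - R) * t - S ≤ Cmin * ((1 - A) * t - B) := by
      linarith [mul_le_mul_of_nonneg_right hA ht]
    have hY : 0 ≤ (1 - A) * t - B :=
      nonneg_of_mul_nonneg_right (by linarith : 0 ≤ Cmin * ((1 - A) * t - B)) hpos
    linarith [mul_le_mul_of_nonneg_right (hle n) hY]
end
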